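/- arXiv:2301.13765 — 10 statements merged into one kernel-verified Lean document; each statement's English description precedes it below -/
import Mathlib

section
/- Let X and Y be compact metric spaces and let f, g, h : X → 2^Y_u be continuous maps into the hyperspace of Y with the upper semifinite topology such that f(x) ⊆ h(x) and g(x) ⊆ h(x) for every x ∈ X. Then f and g are homotopic, i.e., there exists a continuous map H : X × [0,1] → 2^Y_u with H(x,0) = f(x) and H(x,1) = g(x) for all x ∈ X. -/
open Metric Set Filter Topology

/-- The hyperspace of nonempty closed subsets of a topological space. -/
structure Hyper (Y : Type*) [TopologicalSpace Y] where
  carrier : Set Y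
  nonempty' : carrier.Nonempty
  closed' : IsClosed carrier

/-- The upper semifinite topology on the hyperspace: it has as a base the sets
`B(U) = {C : C ⊆ U}` for `U` open in `Y`. -/
instance Hyper.instTopologicalSpace (Y : Type*) [TopologicalSpace Y] :
    TopologicalSpace (Hyper Y) :=
  TopologicalSpace.generateFrom
    {S | ∃ U : Set Y, IsOpen U ∧ S = {C : Hyper Y | C.carrier ⊆ U}}

/-- The canonical copy of a point in the hyperspace. -/
def Hyper.singleton {Y : Type*} [TopologicalSpace Y] [T1Space Y] (y : Y) : Hyper Y :=
  ⟨{y}, Set.singleton_nonempty y, isClosed_singleton⟩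

/-- The nearest-point (multivalued) map `q_A` into the hyperspace. -/
noncomputable def nearestMap {X : Type*} [MetricSpace X] (A : Finset X) (hA : A.Nonempty)
    (x : X) : Hyper X :=
  ⟨{a | a ∈ A ∧ dist x a = infDist x (A : Set X)},
    by
      obtain ⟨a, haA, ha⟩ := A.finite_toSet.isCompact.exists_infDist_eq_dist
        (Finset.coe_nonempty.mpr hA) x
      exact ⟨a, haA, ha.symm⟩,
    (A.finite_toSet.subset fun a ha => Finset.mem_coe.mpr ha.1).isClosed⟩

/-- The sets `{x | f x ⊆ U}` for `U` open are open when `f` is continuous. -/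
theorem Hyper.isOpen_setOf_subset {X Y : Type*} [TopologicalSpace X] [TopologicalSpace Y]
    {f : X → Hyper Y} (hf : Continuous f) {U : Set Y} (hU : IsOpen U) :
    IsOpen {x | (f x).carrier ⊆ U} :=
  have hB : IsOpen {C : Hyper Y | C.carrier ⊆ U} :=
    TopologicalSpace.isOpen_generateFrom_of_mem ⟨U, hU, rfl⟩
  hB.preimage hf

/-- A map into the hyperspace is continuous when the sets `{x | f x ⊆ U}` are open. -/
theorem Hyper.continuous_of_isOpen_setOf_subset {X Y : Type*} [TopologicalSpace X]
    [TopologicalSpace Y] {f : X → Hyper Y}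
    (hf : ∀ U : Set Y, IsOpen U → IsOpen {x | (f x).carrier ⊆ U}) : Continuous f := by
  refine continuous_generateFrom_iff.2 ?_
  rintro _ ⟨U, hU, rfl⟩
  exact hf U hU

/-- Lemma: if `f` and `g` are continuous hyperspace-valued maps whose values are contained
in the values of a third continuous map `h`, then `f` and `g` are homotopic. -/
theorem homotopic_of_subset_of_continuous
    (X Y : Type*) [MetricSpace X] [CompactSpace X] [MetricSpace Y] [CompactSpace Y]
    (f g h : X → Hyper Y) (hf : Continuous f) (hg : Continuous g) (hh : Continuous h)
    (hfh : ∀ x, (f x).carrier ⊆ (h x).carrier) (hgh : ∀ x, (g x).carrier ⊆ (h x).carrier) :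
    ∃ H : X × unitInterval → Hyper Y, Continuous H ∧
      (∀ x, H (x, 0) = f x) ∧ (∀ x, H (x, 1) = g x) := by
  classical
  let c : unitInterval := ⟨1 / 2, by norm_num, by norm_num⟩
  have hc0 : (0 : unitInterval) < c := Subtype.mk_lt_mk.2 (by norm_num)
  have hc1 : c < 1 := Subtype.mk_lt_mk.2 (by norm_num)
  refine ⟨fun p => if p.2 < c then f p.1 else if c < p.2 then g p.1 else h p.1, ?_,
    fun x => if_pos hc0, fun x => (if_neg hc1.not_gt).trans (if_pos hc1)⟩
  refine Hyper.continuous_of_isOpen_setOf_subset fun U hU => ?_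
  have hf' := (Hyper.isOpen_setOf_subset hf hU).prod (isOpen_Iio (a := c))
  have hg' := (Hyper.isOpen_setOf_subset hg hU).prod (isOpen_Ioi (a := c))
  have hh' := (Hyper.isOpen_setOf_subset hh hU).preimage
    (continuous_fst : Continuous (Prod.fst : X × unitInterval → X))
  convert (hf'.union hg').union hh' using 1
  ext ⟨x, t⟩
  have hfU : (h x).carrier ⊆ U → (f x).carrier ⊆ U := (hfh x).trans
  have hgU : (h x).carrier ⊆ U → (g x).carrier ⊆ U := (hgh x).trans
  simp only [mem_ofPred_eq, mem_union, mem_prod, mem_Iio, mem_Ioi, mem_preimage]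
  rcases lt_trichotomy t c with ht | rfl | ht
  · simpa [ht, ht.not_gt] using hfU
  · simp
  · simpa [ht, ht.not_gt] using hgU
end

section
/- Let X be a compact metric space with an adjusted approximative sequence {ε_n, A_n}, and let n < m. Suppose (a_k)_{k=n}^{m} is a chain with a_k ∈ A_k for each n ≤ k ≤ m such that d(a_{k+1}, a_k) = d(a_{k+1}, A_k) for every n ≤ k < m (i.e., a_k is a nearest point of A_k to a_{k+1}). Then d(a_n, a_m) < ε_n. -/
open Metric Set Filter Topology

/-- Lemma (distances in the Main Construction, part ii): if `{ε n, A n}` is an adjusted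
approximative sequence for a compact metric space `X`, `n < m`, and `(a k)` is a chain
with `a k ∈ A k` for `n ≤ k ≤ m` in which `a k` is a nearest point of `A k` to `a (k+1)`
for every `n ≤ k < m`, then `d(a n, a m) < ε n`. -/
theorem dist_chain_lt
    (X : Type*) [MetricSpace X] [CompactSpace X] [Nonempty X]
    (ε : ℕ → ℝ) (A : ℕ → Finset X)
    (hdec : StrictAnti ε) (hpos : ∀ n, 0 < ε n) (hlim : Tendsto ε atTop (nhds 0))
    (hne : ∀ n, (A n).Nonempty)
    (hγ : ∀ n, (⨆ x : X, infDist x (A n : Set X)) < ε n)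
    (hadj : ∀ n, ε (n + 1) < (ε n - ⨆ x : X, infDist x (A n : Set X)) / 2)
    (n m : ℕ) (hnm : n < m) (a : ℕ → X)
    (ha : ∀ k, n ≤ k → k ≤ m → a k ∈ A k)
    (hchain : ∀ k, n ≤ k → k < m →
      dist (a (k + 1)) (a k) = infDist (a (k + 1)) (A k : Set X)) :
    dist (a n) (a m) < ε n := by
  have hstep (k : ℕ) (hnk : n ≤ k) (hkm : k < m) :
      dist (a k) (a (k + 1)) ≤ ⨆ x : X, infDist x (A k : Set X) := by
    rw [dist_comm, hchain k hnk hkm]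
    exact le_ciSup (isCompact_range (continuous_infDist_pt (A k : Set X))).bddAbove (a (k + 1))
  have key (j : ℕ) : ∀ k, n ≤ k → k + j = m → dist (a k) (a m) < ε k := by
    induction j with
    | zero =>
      rintro k - rfl
      simpa using hpos k
    | succ j ih =>
      intro k hnk hkm
      have htail := ih (k + 1) (by omega) (by omega)
      have htri := dist_triangle (a k) (a (k + 1)) (a m)
      linarith [hstep k hnk (by omega), hadj k, hγ k]
  exact key (m - n) n le_rfl (by omega)
end

section
/- Let X be a compact metric space with an adjusted approximative sequence {ε_n, A_n}, let x ∈ X, and let n < m. Suppose (a_k)_{k=n}^{m} is a chain with a_k ∈ A_k for each n ≤ k ≤ m such that d(x, a_m) = d(x, A_m) and d(a_{k+1}, a_k) = d(a_{k+1}, A_k) for every n ≤ k < m. Then d(a_n, x) < ε_n. -/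
open Metric Set Filter Topology

/-- On a compact space, the distance to a set is bounded by its supremum. -/
theorem infDist_le_iSup_of_compactSpace {X : Type*} [PseudoMetricSpace X] [CompactSpace X]
    (s : Set X) (y : X) : infDist y s ≤ ⨆ x : X, infDist x s :=
  le_ciSup (isCompact_range (continuous_infDist_pt s)).bddAbove y

/-- Lemma (distances in the Main Construction, part iii): if `{ε n, A n}` is an adjusted
approximative sequence for a compact metric space `X`, `n < m`, `a m` is a nearest point
of `A m` to `x`, and `(a k)` is a chain with `a k ∈ A k` for `n ≤ k ≤ m` in which `a k`
is a nearest point of `A k` to `a (k+1)` for every `n ≤ k < m`, then `d(a n, x) < ε n`. -/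
theorem dist_chain_to_point_lt
    (X : Type*) [MetricSpace X] [CompactSpace X] [Nonempty X]
    (ε : ℕ → ℝ) (A : ℕ → Finset X)
    (hdec : StrictAnti ε) (hpos : ∀ n, 0 < ε n) (hlim : Tendsto ε atTop (nhds 0))
    (hne : ∀ n, (A n).Nonempty)
    (hγ : ∀ n, (⨆ x : X, infDist x (A n : Set X)) < ε n)
    (hadj : ∀ n, ε (n + 1) < (ε n - ⨆ x : X, infDist x (A n : Set X)) / 2)
    (x : X) (n m : ℕ) (hnm : n < m) (a : ℕ → X)
    (ha : ∀ k, n ≤ k → k ≤ m → a k ∈ A k)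
    (hxam : dist x (a m) = infDist x (A m : Set X))
    (hchain : ∀ k, n ≤ k → k < m →
      dist (a (k + 1)) (a k) = infDist (a (k + 1)) (A k : Set X)) :
    dist (a n) x < ε n := by
  have key : ∀ k, k ≤ m → n ≤ k → dist (a k) x < ε k := by
    intro k hk
    induction hk using Nat.decreasingInduction with
    | self =>
      intro _
      rw [dist_comm, hxam]
      exact (infDist_le_iSup_of_compactSpace _ x).trans_lt (hγ m)
    | of_succ k hk ih =>
      intro hnk
      have hstep := infDist_le_iSup_of_compactSpace (A k : Set X) (a (k + 1))
      rw [← hchain k hnk hk] at hstep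
      linarith [ih (by lia), hadj k, hγ k, dist_triangle_left (a k) x (a (k + 1))]
  exact key n hnm.le le_rfl
end

section
/- Let X be a compact metric space and A ⊆ X a nonempty finite subset. Then the nearest-point map q_A : X → 2^X_u, defined by q_A(x) = {a ∈ A : d(x, a) = d(x, A)}, is continuous, where 2^X_u carries the upper semifinite topology. -/
open Metric Set Filter Topology

/-- The nearest-point map `q_A : X → 2^X_u`, sending `x` to the set of points of the
nonempty finite set `A` nearest to `x`, is continuous for the upper semifinite topology. -/
theorem nearestMap_continuous
    (X : Type*) [MetricSpace X] [CompactSpace X] (A : Finset X) (hA : A.Nonempty) :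
    Continuous (nearestMap A hA) := by
  refine continuous_generateFrom_iff.mpr ?_
  rintro _ ⟨U, -, rfl⟩
  have h : nearestMap A hA ⁻¹' {C | C.carrier ⊆ U} =
      (⋃ a ∈ (A : Set X) \ U, {x | dist x a = infDist x (A : Set X)})ᶜ := by
    ext x
    simp only [nearestMap, mem_preimage, mem_ofPred_eq, subset_def, mem_compl_iff, mem_iUnion,
      Set.mem_sdiff, Finset.mem_coe, exists_prop]
    grind
  rw [h, isOpen_compl_iff]
  exact (A.finite_toSet.subset sdiff_subset).isClosed_biUnion fun a _ =>
    isClosed_eq (by fun_prop) (continuous_infDist_pt _)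
end

section
/- Let Y be a compact metric space and B ⊆ Y a nonempty finite subset. Then the map r_B : 2^Y_u → 2^Y_u defined by r_B(C) = {b ∈ B : there exists y ∈ C with d(y, b) = d(y, B)} (the extension of the nearest-point map q_B to the hyperspace) is continuous, where 2^Y_u carries the upper semifinite topology. -/
open Metric Set Filter Topology

/-- The extension of the nearest-point map to the hyperspace. -/
noncomputable def nearestMapExt {Y : Type*} [MetricSpace Y] (B : Finset Y)
    (hB : B.Nonempty) (C : Hyper Y) : Hyper Y :=
  ⟨{b | b ∈ B ∧ ∃ y ∈ C.carrier, dist y b = infDist y (B : Set Y)},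
    by
      obtain ⟨y, hy⟩ := C.nonempty'
      obtain ⟨b, hbB, hb⟩ := B.finite_toSet.isCompact.exists_infDist_eq_dist
        (Finset.coe_nonempty.mpr hB) y
      exact ⟨b, hbB, y, hy, hb.symm⟩,
    (B.finite_toSet.subset fun b hb => Finset.mem_coe.mpr hb.1).isClosed⟩

/-- The extension `r_B : 2^Y_u → 2^Y_u` of the nearest-point map `q_B` to the hyperspace
is continuous for the upper semifinite topology. -/
theorem nearestMapExt_continuous
    (Y : Type*) [MetricSpace Y] [CompactSpace Y] (B : Finset Y) (hB : B.Nonempty) :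
    Continuous (nearestMapExt B hB) := by
  refine continuous_generateFrom_iff.mpr ?_
  rintro _ ⟨U, -, rfl⟩
  have hV : IsOpen (⋂ b ∈ {b | b ∈ B ∧ b ∉ U}, {y : Y | dist y b ≠ infDist y (B : Set Y)}) :=
    (B.finite_toSet.subset fun b hb => Finset.mem_coe.mpr hb.1).isOpen_biInter fun b _ =>
      isOpen_ne_fun (continuous_id.dist continuous_const) (continuous_infDist_pt _)
  refine TopologicalSpace.isOpen_generateFrom_of_mem ⟨_, hV, ?_⟩
  ext C
  simp only [mem_preimage, mem_ofPred_eq, nearestMapExt, subset_def, mem_iInter]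
  constructor
  · exact fun h y hy b hb hd => hb.2 (h b ⟨hb.1, y, hy, hd⟩)
  · rintro h b ⟨hb, y, hy, hd⟩
    by_contra hU
    exact h y hy b ⟨hb, hU⟩ hd
end

section
/- Let X be a compact metric space. For every ε > 0, the set U_ε = {C ∈ 2^X : diam(C) < ε} is open in 2^X_u; moreover, the family {U_ε : ε > 0} is a base of open neighborhoods of the canonical copy of X in 2^X_u, i.e., for every open set U ⊆ 2^X_u containing {x} for every x ∈ X, there exists ε > 0 such that U_ε ⊆ U. -/
open Metric Set Filter Topology

theorem Hyper.isOpen_setOf_subset_s9 {Y : Type*} [TopologicalSpace Y] {V : Set Y} (hV : IsOpen V) :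
    IsOpen {C : Hyper Y | C.carrier ⊆ V} :=
  TopologicalSpace.isOpen_generateFrom_of_mem ⟨V, hV, rfl⟩

/-- The sets `B(V)` with `V` open form a base, and not merely a subbase, of the upper
semifinite topology. -/
theorem Hyper.isOpen_iff {Y : Type*} [TopologicalSpace Y] {U : Set (Hyper Y)} :
    IsOpen U ↔ ∀ C ∈ U, ∃ V : Set Y, IsOpen V ∧ C.carrier ⊆ V ∧
      {D : Hyper Y | D.carrier ⊆ V} ⊆ U := by
  constructor
  · intro hU
    induction hU with
    | basic S hS =>
      obtain ⟨V, hV, rfl⟩ := hS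
      exact fun C hC => ⟨V, hV, hC, Subset.rfl⟩
    | univ => exact fun C _ => ⟨univ, isOpen_univ, subset_univ _, subset_univ _⟩
    | inter S T _ _ ihS ihT =>
      intro C hC
      obtain ⟨V, hV, hCV, hVS⟩ := ihS C hC.1
      obtain ⟨W, hW, hCW, hWT⟩ := ihT C hC.2
      exact ⟨V ∩ W, hV.inter hW, subset_inter hCV hCW, fun D hD =>
        ⟨hVS (hD.trans inter_subset_left), hWT (hD.trans inter_subset_right)⟩⟩
    | sUnion 𝒮 _ ih =>
      rintro C ⟨S, hS, hCS⟩
      obtain ⟨V, hV, hCV, hVS⟩ := ih S hS C hCS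
      exact ⟨V, hV, hCV, hVS.trans (subset_sUnion_of_mem hS)⟩
  · intro h
    refine isOpen_iff_forall_mem_open.2 fun C hC => ?_
    obtain ⟨V, hV, hCV, hVU⟩ := h C hC
    exact ⟨_, hVU, Hyper.isOpen_setOf_subset_s9 hV, hCV⟩

/-- For a compact metric space `X`, each `U_ε = {C : diam C < ε}` is open in `2^X_u`, and
the family `{U_ε : ε > 0}` is a base of open neighborhoods of the canonical copy of `X`
(the set of singletons) in `2^X_u`. -/
theorem diam_lt_sets_basis_of_canonical_copy
    (X : Type*) [MetricSpace X] [CompactSpace X] :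
    (∀ ε : ℝ, 0 < ε → IsOpen {C : Hyper X | diam C.carrier < ε}) ∧
    (∀ U : Set (Hyper X), IsOpen U → (∀ x : X, Hyper.singleton x ∈ U) →
      ∃ ε : ℝ, 0 < ε ∧ {C : Hyper X | diam C.carrier < ε} ⊆ U) := by
  constructor
  · refine fun ε _ => Hyper.isOpen_iff.2 fun C (hC : diam C.carrier < ε) => ?_
    have hr : 0 < (ε - diam C.carrier) / 3 := by linarith
    refine ⟨thickening ((ε - diam C.carrier) / 3) C.carrier, isOpen_thickening,
      self_subset_thickening hr _, fun D hD => ?_⟩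
    have hle := diam_mono hD isBounded_of_compactSpace
    have hth := diam_thickening_le C.carrier hr.le
    change diam D.carrier < ε
    linarith
  · intro U hU hX
    choose V hV hxV hVU using fun x : X => Hyper.isOpen_iff.1 hU _ (hX x)
    obtain ⟨δ, hδ, hball⟩ := lebesgue_number_lemma_of_metric isCompact_univ hV
      fun x _ => mem_iUnion.2 ⟨x, hxV x (mem_singleton x)⟩
    refine ⟨δ, hδ, fun C (hC : diam C.carrier < δ) => ?_⟩
    obtain ⟨x, hx⟩ := C.nonempty'
    obtain ⟨i, hi⟩ := hball x (mem_univ x)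
    exact hVU i fun y hy =>
      hi ((dist_le_diam_of_mem isBounded_of_compactSpace hy hx).trans_lt hC)
end

section
/- Let X be a compact metric space with an adjusted approximative sequence {ε_n, A_n} and let q_{A_n} : X → 2^X_u be the nearest-point maps, q_{A_n}(x) = {a ∈ A_n : d(x, a) = d(x, A_n)}. For every x ∈ X and every n, the set q_{A_n}(x) ∪ q_{A_{n+1}}(x) has diameter strictly less than 2ε_n, and in particular is contained in U_{2ε_n} = {C ∈ 2^X : diam(C) < 2ε_n}. -/
open Metric Set Filter Topology

theorem infDist_le_iSup_infDist {X : Type*} [PseudoMetricSpace X] [CompactSpace X]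
    (s : Set X) (x : X) : infDist x s ≤ ⨆ y : X, infDist y s :=
  le_ciSup (isCompact_range (continuous_infDist_pt s)).bddAbove x

theorem diam_union_nearest_le {X : Type*} [PseudoMetricSpace X] (s t : Set X) (x : X) :
    diam ({a | a ∈ s ∧ dist x a = infDist x s} ∪ {a | a ∈ t ∧ dist x a = infDist x t}) ≤
      2 * max (infDist x s) (infDist x t) := by
  have hr : ∀ a ∈ {a | a ∈ s ∧ dist x a = infDist x s} ∪ {a | a ∈ t ∧ dist x a = infDist x t},
      dist x a ≤ max (infDist x s) (infDist x t) := by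
    rintro a (⟨-, h⟩ | ⟨-, h⟩) <;> simp [h]
  refine diam_le_of_forall_dist_le
    (mul_nonneg two_pos.le (le_max_of_le_left infDist_nonneg)) fun a ha b hb => ?_
  linarith [dist_triangle_left a b x, hr a ha, hr b hb]

/-- For an adjusted approximative sequence `{ε n, A n}` of a compact metric space `X`,
the union `q_{A n}(x) ∪ q_{A (n+1)}(x)` of the sets of nearest points has diameter
strictly less than `2 ε n`; in particular it lies in `U_{2 ε n}`. -/
theorem diam_union_nearest_lt
    (X : Type*) [MetricSpace X] [CompactSpace X] [Nonempty X]
    (ε : ℕ → ℝ) (A : ℕ → Finset X)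
    (hdec : StrictAnti ε) (hpos : ∀ n, 0 < ε n) (hlim : Tendsto ε atTop (nhds 0))
    (hne : ∀ n, (A n).Nonempty)
    (hγ : ∀ n, (⨆ x : X, infDist x (A n : Set X)) < ε n)
    (hadj : ∀ n, ε (n + 1) < (ε n - ⨆ x : X, infDist x (A n : Set X)) / 2)
    (x : X) (n : ℕ) :
    diam ({a | a ∈ A n ∧ dist x a = infDist x (A n : Set X)} ∪
        {a | a ∈ A (n + 1) ∧ dist x a = infDist x (A (n + 1) : Set X)}) < 2 * ε n ∧
    ({a | a ∈ A n ∧ dist x a = infDist x (A n : Set X)} ∪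
        {a | a ∈ A (n + 1) ∧ dist x a = infDist x (A (n + 1) : Set X)}) ∈
      {C : Set X | diam C < 2 * ε n} := by
  have hlt (m : ℕ) : infDist x (A m : Set X) < ε m :=
    (infDist_le_iSup_infDist (A m : Set X) x).trans_lt (hγ m)
  have hn := hlt n
  have hn1 := (hlt (n + 1)).trans (hdec n.lt_succ_self)
  have key := diam_union_nearest_le (A n : Set X) (A (n + 1) : Set X) x
  have hmax := max_lt hn hn1
  simp only [Finset.mem_coe] at key
  have h := key.trans_lt (mul_lt_mul_of_pos_left hmax two_pos)
  exact ⟨h, h⟩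
end

section
/- Let X be a compact metric space with an adjusted approximative sequence {ε_n, A_n} and nearest-point maps q_{A_n} : X → 2^X_u, q_{A_n}(x) = {a ∈ A_n : d(x, a) = d(x, A_n)}. Then the sequence {q_{A_n}} is an approximative map from X to X: each q_{A_n} is continuous, and for every open set U ⊆ 2^X_u containing the canonical copy of X there exists n_0 such that for every n ≥ n_0 there is a continuous homotopy H : X × [0,1] → 2^X_u with H(x,0) = q_{A_n}(x), H(x,1) = q_{A_{n+1}}(x) and H(x,t) ∈ U for all (x,t). -/
open Metric Set Filter Topology

namespace Hyper

section

variable {Y : Type*} [TopologicalSpace Y]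

theorem isOpen_setOf_carrier_subset {V : Set Y} (hV : IsOpen V) :
    IsOpen {C : Hyper Y | C.carrier ⊆ V} :=
  TopologicalSpace.isOpen_generateFrom_of_mem ⟨V, hV, rfl⟩

theorem isTopologicalBasis :
    TopologicalSpace.IsTopologicalBasis
      {S | ∃ V : Set Y, IsOpen V ∧ S = {C : Hyper Y | C.carrier ⊆ V}} where
  exists_subset_inter := by
    rintro _ ⟨V, hV, rfl⟩ _ ⟨W, hW, rfl⟩ C hC
    exact ⟨_, ⟨V ∩ W, hV.inter hW, rfl⟩, subset_inter hC.1 hC.2, fun _ hD =>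
      ⟨hD.trans inter_subset_left, hD.trans inter_subset_right⟩⟩
  sUnion_eq := sUnion_eq_univ_iff.mpr fun _ =>
    ⟨_, ⟨univ, isOpen_univ, rfl⟩, subset_univ _⟩
  eq_generateFrom := rfl

theorem continuous_iff {Z : Type*} [TopologicalSpace Z] {f : Z → Hyper Y} :
    Continuous f ↔ ∀ V : Set Y, IsOpen V → IsOpen {z | (f z).carrier ⊆ V} := by
  refine ⟨fun hf V hV => (isOpen_setOf_carrier_subset hV).preimage hf, fun h => ?_⟩
  refine continuous_generateFrom_iff.mpr ?_
  rintro _ ⟨V, hV, rfl⟩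
  exact h V hV

/-- The union of two members of the hyperspace. -/
def union (C D : Hyper Y) : Hyper Y :=
  ⟨C.carrier ∪ D.carrier, C.nonempty'.inl, C.closed'.union D.closed'⟩

open Classical in
/-- The homotopy between two hyperspace-valued maps which follows the first map before time
`1 / 2`, the second one after it, and takes their union at time `1 / 2`. -/
noncomputable def unionHomotopy {Z : Type*} (f g : Z → Hyper Y) (p : Z × unitInterval) :
    Hyper Y :=
  if (p.2 : ℝ) < 1 / 2 then f p.1
  else if 1 / 2 < (p.2 : ℝ) then g p.1 else union (f p.1) (g p.1)

theorem unionHomotopy_carrier_subset_iff {Z : Type*} {f g : Z → Hyper Y}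
    {p : Z × unitInterval} {V : Set Y} :
    (unionHomotopy f g p).carrier ⊆ V ↔
      (1 / 2 < (p.2 : ℝ) ∨ (f p.1).carrier ⊆ V) ∧
        ((p.2 : ℝ) < 1 / 2 ∨ (g p.1).carrier ⊆ V) := by
  unfold unionHomotopy
  split_ifs with h₁ h₂
  · simp [h₁, h₁.not_gt, -one_div]
  · simp [h₁, h₂, -one_div]
  · simp [h₁, h₂, union, -one_div]

theorem continuous_unionHomotopy {Z : Type*} [TopologicalSpace Z] {f g : Z → Hyper Y}
    (hf : Continuous f) (hg : Continuous g) : Continuous (unionHomotopy f g) := by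
  refine continuous_iff.mpr fun V hV => ?_
  simp only [unionHomotopy_carrier_subset_iff]
  have ht : Continuous fun p : Z × unitInterval => (p.2 : ℝ) := by fun_prop
  exact ((isOpen_lt continuous_const ht).union
      ((continuous_iff.mp hf V hV).preimage continuous_fst)).inter
    ((isOpen_lt ht continuous_const).union
      ((continuous_iff.mp hg V hV).preimage continuous_fst))

end

/-- An open neighborhood of the canonical copy of a compact metric space contains all
sufficiently small closed sets. -/
theorem exists_forall_subset_ball_mem {X : Type*} [MetricSpace X] [CompactSpace X]
    {U : Set (Hyper X)} (hU : IsOpen U) (hs : ∀ x, singleton x ∈ U) :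
    ∃ δ > 0, ∀ (x : X) (C : Hyper X), C.carrier ⊆ ball x δ → C ∈ U := by
  have h : ∀ x : X, ∃ V : Set X, IsOpen V ∧ x ∈ V ∧ ∀ C : Hyper X, C.carrier ⊆ V → C ∈ U := by
    intro x
    obtain ⟨_, ⟨V, hV, rfl⟩, hx, hVU⟩ :=
      isTopologicalBasis.exists_subset_of_mem_open (hs x) hU
    exact ⟨V, hV, hx rfl, fun C hC => hVU hC⟩
  choose V hV hxV hVU using h
  obtain ⟨δ, hδ, hball⟩ := lebesgue_number_lemma_of_metric isCompact_univ hV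
    fun x _ => mem_iUnion.mpr ⟨x, hxV x⟩
  refine ⟨δ, hδ, fun x C hC => ?_⟩
  obtain ⟨y, hy⟩ := hball x (mem_univ x)
  exact hVU y C (hC.trans hy)

end Hyper

theorem continuous_nearestMap {X : Type*} [MetricSpace X] (A : Finset X) (hA : A.Nonempty) :
    Continuous (nearestMap A hA) := by
  refine Hyper.continuous_iff.mpr fun V _ => ?_
  have h : {x | (nearestMap A hA x).carrier ⊆ V} =
      (⋃ a ∈ (A : Set X) \ V, {x | dist x a = infDist x (A : Set X)})ᶜ := by
    ext x
    simp only [nearestMap, Set.subset_def, mem_ofPred_eq, mem_compl_iff, mem_iUnion, Set.mem_sdiff,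
      Finset.mem_coe, not_exists]
    grind
  rw [h, isOpen_compl_iff]
  exact (A.finite_toSet.sdiff).isClosed_biUnion fun a _ =>
    isClosed_eq (by fun_prop) (continuous_infDist_pt _)

theorem nearestMap_carrier_subset_ball {X : Type*} [MetricSpace X] [CompactSpace X]
    (A : Finset X) (hA : A.Nonempty) {r : ℝ} (hr : (⨆ x : X, infDist x (A : Set X)) < r)
    (x : X) : (nearestMap A hA x).carrier ⊆ ball x r := by
  rintro a ⟨-, ha⟩
  have hbdd := (isCompact_range (continuous_infDist_pt (A : Set X))).bddAbove
  rw [mem_ball', ha]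
  exact (le_ciSup hbdd x).trans_lt hr

/-- The sequence of nearest-point maps `q_{A n}` associated to an adjusted approximative
sequence of a compact metric space `X` is an approximative map from `X` to `X`: each
`q_{A n}` is continuous, and for every open neighborhood `U` of the canonical copy of `X`
in `2^X_u` the maps `q_{A n}` and `q_{A (n+1)}` are eventually homotopic within `U`. -/
theorem nearestMaps_approximative_map
    (X : Type*) [MetricSpace X] [CompactSpace X] [Nonempty X]
    (ε : ℕ → ℝ) (A : ℕ → Finset X)
    (hdec : StrictAnti ε) (hpos : ∀ n, 0 < ε n) (hlim : Tendsto ε atTop (nhds 0))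
    (hne : ∀ n, (A n).Nonempty)
    (hγ : ∀ n, (⨆ x : X, infDist x (A n : Set X)) < ε n)
    (hadj : ∀ n, ε (n + 1) < (ε n - ⨆ x : X, infDist x (A n : Set X)) / 2) :
    (∀ n, Continuous (nearestMap (A n) (hne n))) ∧
    (∀ U : Set (Hyper X), IsOpen U → (∀ x : X, Hyper.singleton x ∈ U) →
      ∃ n₀ : ℕ, ∀ n, n₀ ≤ n → ∃ H : X × unitInterval → Hyper X, Continuous H ∧
        (∀ x, H (x, 0) = nearestMap (A n) (hne n) x) ∧
        (∀ x, H (x, 1) = nearestMap (A (n + 1)) (hne (n + 1)) x) ∧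
        (∀ p, H p ∈ U)) := by
  refine ⟨fun n => continuous_nearestMap _ _, fun U hU hs => ?_⟩
  obtain ⟨δ, hδ, hmem⟩ := Hyper.exists_forall_subset_ball_mem hU hs
  obtain ⟨n₀, hn₀⟩ := eventually_atTop.mp (hlim.eventually_lt_const hδ)
  have hball : ∀ n, n₀ ≤ n → ∀ x, (nearestMap (A n) (hne n) x).carrier ⊆ ball x δ :=
    fun n hn => nearestMap_carrier_subset_ball _ _ ((hγ n).trans (hn₀ n hn))
  refine ⟨n₀, fun n hn => ⟨Hyper.unionHomotopy (nearestMap (A n) (hne n))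
    (nearestMap (A (n + 1)) (hne (n + 1))), Hyper.continuous_unionHomotopy
      (continuous_nearestMap _ _) (continuous_nearestMap _ _), fun x => ?_, fun x => ?_,
    fun p => hmem p.1 _ (Hyper.unionHomotopy_carrier_subset_iff.mpr
      ⟨Or.inr (hball n hn p.1), Or.inr (hball (n + 1) (by lia) p.1)⟩)⟩⟩
  · simp [Hyper.unionHomotopy]
  · have h₁ : ¬(1 : ℝ) < 1 / 2 := by norm_num
    have h₂ : (1 : ℝ) / 2 < 1 := by norm_num
    simp [Hyper.unionHomotopy, h₁, h₂, -one_div]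
end

section
/- Let X be a compact metric space with an adjusted approximative sequence {ε_n, A_n} and nearest-point maps q_{A_n} : X → 2^X_u, q_{A_n}(x) = {a ∈ A_n : d(x, a) = d(x, A_n)}. Then the approximative map {q_{A_n}} is homotopic to the identity approximative map {id} given by id(x) = {x}: for every open set U ⊆ 2^X_u containing the canonical copy of X there exists n_0 such that for every n ≥ n_0 there is a continuous homotopy H : X × [0,1] → 2^X_u with H(x,0) = q_{A_n}(x), H(x,1) = {x} and H(x,t) ∈ U for all (x,t). -/
open Metric Set Filter Topology

/-- The sets `{C | C ⊆ V}` with `V` open form a neighborhood base in the hyperspace. -/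
theorem Hyper.exists_isOpen_subset {Y : Type*} [TopologicalSpace Y] {U : Set (Hyper Y)}
    (hU : IsOpen U) {C : Hyper Y} (hC : C ∈ U) :
    ∃ V : Set Y, IsOpen V ∧ C.carrier ⊆ V ∧ ∀ D : Hyper Y, D.carrier ⊆ V → D ∈ U := by
  induction hU with
  | basic S hS =>
    obtain ⟨V, hV, rfl⟩ := hS
    exact ⟨V, hV, hC, fun _ hD => hD⟩
  | univ => exact ⟨Set.univ, isOpen_univ, Set.subset_univ _, fun _ _ => Set.mem_univ _⟩
  | inter S T _ _ ihS ihT =>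
    obtain ⟨V, hV, hCV, hVS⟩ := ihS hC.1
    obtain ⟨W, hW, hCW, hWT⟩ := ihT hC.2
    exact ⟨V ∩ W, hV.inter hW, Set.subset_inter hCV hCW, fun D hD =>
      ⟨hVS D (hD.trans Set.inter_subset_left), hWT D (hD.trans Set.inter_subset_right)⟩⟩
  | sUnion 𝒮 _ ih =>
    obtain ⟨S, hS, hCS⟩ := hC
    obtain ⟨V, hV, hCV, hVS⟩ := ih S hS hCS
    exact ⟨V, hV, hCV, fun D hD => ⟨S, hS, hVS D hD⟩⟩

theorem Hyper.ext_carrier {Y : Type*} [TopologicalSpace Y] {C D : Hyper Y}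
    (h : C.carrier = D.carrier) : C = D := by
  cases C
  cases D
  cases h
  rfl

theorem Hyper.continuous_iff_s12 {Y Z : Type*} [TopologicalSpace Y] [TopologicalSpace Z]
    {f : Z → Hyper Y} :
    Continuous f ↔ ∀ V : Set Y, IsOpen V → IsOpen {z | (f z).carrier ⊆ V} := by
  refine continuous_generateFrom_iff.trans ⟨fun h V hV => h _ ⟨V, hV, rfl⟩, ?_⟩
  rintro h _ ⟨V, hV, rfl⟩
  exact h V hV

/-- In a compact metric space, an open neighborhood of the canonical copy contains all closed
sets of sufficiently small size. -/
theorem Hyper.exists_forall_subset_ball_mem_s12 {X : Type*} [MetricSpace X] [CompactSpace X]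
    {U : Set (Hyper X)} (hU : IsOpen U) (hsing : ∀ x : X, Hyper.singleton x ∈ U) :
    ∃ δ > 0, ∀ (x : X) (C : Hyper X), C.carrier ⊆ ball x δ → C ∈ U := by
  choose V hV hxV hVU using fun x => Hyper.exists_isOpen_subset hU (hsing x)
  obtain ⟨δ, hδ, h⟩ := lebesgue_number_lemma_of_metric (isCompact_univ (X := X)) hV
    fun x _ => Set.mem_iUnion.mpr ⟨x, hxV x rfl⟩
  refine ⟨δ, hδ, fun x C hC => ?_⟩
  obtain ⟨i, hi⟩ := h x (Set.mem_univ x)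
  exact hVU i C (hC.trans hi)

/-- Two maps into the hyperspace are joined through their pointwise union: the first map for
`t < 1/2`, the union at `t = 1/2`, the second map for `t > 1/2`. -/
def Hyper.join {Y Z : Type*} [TopologicalSpace Y] (f g : Z → Hyper Y)
    (p : Z × unitInterval) : Hyper Y where
  carrier := {y | (p.2 : ℝ) ≤ 1 / 2 ∧ y ∈ (f p.1).carrier ∨
    1 / 2 ≤ (p.2 : ℝ) ∧ y ∈ (g p.1).carrier}
  nonempty' := by
    obtain ⟨y, hy⟩ := (f p.1).nonempty'
    obtain ⟨z, hz⟩ := (g p.1).nonempty'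
    exact (le_total (p.2 : ℝ) (1 / 2)).elim (fun h => ⟨y, .inl ⟨h, hy⟩⟩)
      fun h => ⟨z, .inr ⟨h, hz⟩⟩
  closed' := (isClosed_const.inter (f p.1).closed').union
    (isClosed_const.inter (g p.1).closed')

theorem Hyper.join_zero {Y Z : Type*} [TopologicalSpace Y] (f g : Z → Hyper Y) (z : Z) :
    Hyper.join f g (z, 0) = f z := by
  apply Hyper.ext_carrier
  ext y
  norm_num [Hyper.join]

theorem Hyper.join_one {Y Z : Type*} [TopologicalSpace Y] (f g : Z → Hyper Y) (z : Z) :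
    Hyper.join f g (z, 1) = g z := by
  apply Hyper.ext_carrier
  ext y
  norm_num [Hyper.join]

theorem Hyper.join_subset {Y Z : Type*} [TopologicalSpace Y] {f g : Z → Hyper Y} {V : Set Y}
    {p : Z × unitInterval} (hf : (f p.1).carrier ⊆ V) (hg : (g p.1).carrier ⊆ V) :
    (Hyper.join f g p).carrier ⊆ V := by
  rintro y (⟨-, hy⟩ | ⟨-, hy⟩)
  exacts [hf hy, hg hy]

theorem Hyper.continuous_join {Y Z : Type*} [TopologicalSpace Y] [TopologicalSpace Z]
    {f g : Z → Hyper Y} (hf : Continuous f) (hg : Continuous g) :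
    Continuous (Hyper.join f g) := by
  refine Hyper.continuous_iff_s12.mpr fun V hV => ?_
  have : {p | (Hyper.join f g p).carrier ⊆ V} =
      ({p | 1 / 2 < (p.2 : ℝ)} ∪ {p | (f p.1).carrier ⊆ V}) ∩
        ({p | (p.2 : ℝ) < 1 / 2} ∪ {p | (g p.1).carrier ⊆ V}) := by
    ext p
    simp only [Hyper.join, Set.subset_def, Set.mem_ofPred_eq, Set.mem_inter_iff, Set.mem_union,
      or_imp, and_imp, forall_and]
    simp only [imp_iff_not_or, not_le, forall_or_left]
  rw [this]
  exact ((isOpen_lt (by fun_prop) (by fun_prop)).union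
      ((Hyper.continuous_iff_s12.mp hf V hV).preimage continuous_fst)).inter
    ((isOpen_lt (by fun_prop) (by fun_prop)).union
      ((Hyper.continuous_iff_s12.mp hg V hV).preimage continuous_fst))

theorem Hyper.continuous_singleton {Y : Type*} [TopologicalSpace Y] [T1Space Y] :
    Continuous (Hyper.singleton : Y → Hyper Y) :=
  Hyper.continuous_iff_s12.mpr fun V hV => by simpa [Hyper.singleton] using hV

/-- The approximative map given by the nearest-point maps `q_{A n}` of an adjusted
approximative sequence is homotopic to the identity approximative map `x ↦ {x}`:
for every open neighborhood `U` of the canonical copy of `X` in `2^X_u`, eventually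
`q_{A n}` is homotopic to `x ↦ {x}` within `U`. -/
theorem nearestMaps_homotopic_to_identity
    (X : Type*) [MetricSpace X] [CompactSpace X] [Nonempty X]
    (ε : ℕ → ℝ) (A : ℕ → Finset X)
    (hdec : StrictAnti ε) (hpos : ∀ n, 0 < ε n) (hlim : Tendsto ε atTop (nhds 0))
    (hne : ∀ n, (A n).Nonempty)
    (hγ : ∀ n, (⨆ x : X, infDist x (A n : Set X)) < ε n)
    (hadj : ∀ n, ε (n + 1) < (ε n - ⨆ x : X, infDist x (A n : Set X)) / 2) :
    ∀ U : Set (Hyper X), IsOpen U → (∀ x : X, Hyper.singleton x ∈ U) →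
      ∃ n₀ : ℕ, ∀ n, n₀ ≤ n → ∃ H : X × unitInterval → Hyper X, Continuous H ∧
        (∀ x, H (x, 0) = nearestMap (A n) (hne n) x) ∧
        (∀ x, H (x, 1) = Hyper.singleton x) ∧
        (∀ p, H p ∈ U) := by
  intro U hU hsing
  obtain ⟨δ, hδ, hball⟩ := Hyper.exists_forall_subset_ball_mem_s12 hU hsing
  obtain ⟨n₀, hn₀⟩ := eventually_atTop.mp (hlim.eventually_lt_const hδ)
  refine ⟨n₀, fun n hn => ⟨Hyper.join (nearestMap (A n) (hne n)) Hyper.singleton,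
    Hyper.continuous_join (continuous_nearestMap _ _) Hyper.continuous_singleton,
    Hyper.join_zero _ _, Hyper.join_one _ _, fun p => hball p.1 _ (Hyper.join_subset ?_ ?_)⟩⟩
  · rintro a ⟨-, ha⟩
    have hle : infDist p.1 (A n : Set X) ≤ ⨆ x : X, infDist x (A n : Set X) :=
      le_ciSup (isCompact_range (continuous_infDist_pt (A n : Set X))).bddAbove p.1
    rw [mem_ball', ha]
    exact hle.trans_lt ((hγ n).trans (hn₀ n hn))
  · exact Set.singleton_subset_iff.mpr (mem_ball_self hδ)
end

section
/- Let X be a compact metric space with an adjusted approximative sequence {ε_n, A_n} and nearest-point maps q_{A_n}(x) = {a ∈ A_n : d(x, a) = d(x, A_n)}, and let p_{n,n+1}(C) = {a ∈ A_n : there exists c ∈ C with d(c, a) = d(c, A_n)} for nonempty C ⊆ A_{n+1}. Then for every x ∈ X and every n, the set q_{A_n}(x) ∪ p_{n,n+1}(q_{A_{n+1}}(x)) is a subset of A_n of diameter strictly less than 2ε_n. -/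
open Metric Set Filter Topology

/-- For an adjusted approximative sequence `{ε n, A n}` of a compact metric space `X`,
the set `q_{A n}(x) ∪ p_{n,n+1}(q_{A (n+1)}(x))` is a subset of `A n` of diameter
strictly less than `2 ε n`. -/
theorem diam_union_nearest_bonded_lt
    (X : Type*) [MetricSpace X] [CompactSpace X] [Nonempty X]
    (ε : ℕ → ℝ) (A : ℕ → Finset X)
    (hdec : StrictAnti ε) (hpos : ∀ n, 0 < ε n) (hlim : Tendsto ε atTop (nhds 0))
    (hne : ∀ n, (A n).Nonempty)
    (hγ : ∀ n, (⨆ x : X, infDist x (A n : Set X)) < ε n)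
    (hadj : ∀ n, ε (n + 1) < (ε n - ⨆ x : X, infDist x (A n : Set X)) / 2)
    (x : X) (n : ℕ) :
    ({a | a ∈ A n ∧ dist x a = infDist x (A n : Set X)} ∪
      {a | a ∈ A n ∧ ∃ c, (c ∈ A (n + 1) ∧ dist x c = infDist x (A (n + 1) : Set X)) ∧
        dist c a = infDist c (A n : Set X)}) ⊆ (A n : Set X) ∧
    diam ({a | a ∈ A n ∧ dist x a = infDist x (A n : Set X)} ∪
      {a | a ∈ A n ∧ ∃ c, (c ∈ A (n + 1) ∧ dist x c = infDist x (A (n + 1) : Set X)) ∧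
        dist c a = infDist c (A n : Set X)}) < 2 * ε n := by
  have hle (m : ℕ) (y : X) :
      infDist y (A m : Set X) ≤ ⨆ z : X, infDist z (A m : Set X) :=
    le_ciSup (isCompact_range (continuous_infDist_pt (A m : Set X))).bddAbove y
  have hnonneg (m : ℕ) : 0 ≤ ⨆ z : X, infDist z (A m : Set X) :=
    Real.iSup_nonneg fun _ => infDist_nonneg
  set γ : ℕ → ℝ := fun m => ⨆ z : X, infDist z (A m : Set X)
  refine ⟨by rintro a (ha | ha) <;> exact ha.1, ?_⟩
  have hball : ({a | a ∈ A n ∧ dist x a = infDist x (A n : Set X)} ∪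
      {a | a ∈ A n ∧ ∃ c, (c ∈ A (n + 1) ∧ dist x c = infDist x (A (n + 1) : Set X)) ∧
        dist c a = infDist c (A n : Set X)}) ⊆ closedBall x (γ n + γ (n + 1)) := by
    rintro a (⟨-, ha⟩ | ⟨-, c, ⟨-, hc⟩, hca⟩) <;> rw [mem_closedBall']
    · linarith [hle n x, hnonneg (n + 1)]
    · linarith [dist_triangle x c a, hle n c, hle (n + 1) x]
  calc
    _ ≤ diam (closedBall x (γ n + γ (n + 1))) := diam_mono hball isBounded_closedBall
    _ ≤ 2 * (γ n + γ (n + 1)) := diam_closedBall (add_nonneg (hnonneg n) (hnonneg (n + 1)))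
    _ < 2 * ε n := by linarith [hγ n, hγ (n + 1), hadj n]
end
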